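/- (Kalman analysis step.) Let H ∈ ℝ^{d×n}, c ∈ ℝ^d, let R ∈ ℝ^{d×d} and Σ_b ∈ ℝ^{n×n} be symmetric positive definite, let μ_b ∈ ℝ^n and y ∈ ℝ^d. Define the prior density q_b = N(μ_b, Σ_b) on ℝ^n and the observation likelihood ℓ(x) = N(Hx + c, R)(y). Then the normalized posterior density x ↦ ℓ(x) q_b(x) / ∫ ℓ(z) q_b(z) dz equals the Gaussian density N(μ_a, Σ_a) with Σ_a = ( Hᵀ R^{−1} H + Σ_b^{−1} )^{−1} and μ_a = μ_b + Σ_a Hᵀ R^{−1} ( y − (Hμ_b + c) ). -/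

import Mathlib

open MeasureTheory Matrix Real
open scoped ENNReal

noncomputable section

/-- The Gaussian probability density on `ℝ^k` with mean `m` and symmetric
positive-definite covariance matrix `S`. -/
def gaussD {k : ℕ} (m : Fin k → ℝ) (S : Matrix (Fin k) (Fin k) ℝ) (x : Fin k → ℝ) : ℝ :=
  (2 * π) ^ (-(k : ℝ) / 2) * S.det ^ (-(1 : ℝ) / 2) *
    Real.exp (-((x - m) ⬝ᵥ (S⁻¹ *ᵥ (x - m))) / 2)

open scoped MatrixOrder in
/-- A real positive definite matrix is `Bᵀ B` with `B` invertible. -/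
lemma Matrix.PosDef.exists_transpose_mul_self {k : ℕ} {P : Matrix (Fin k) (Fin k) ℝ}
    (hP : P.PosDef) : ∃ B : Matrix (Fin k) (Fin k) ℝ, B.det ≠ 0 ∧ P = Bᵀ * B := by
  obtain ⟨B, hB⟩ := CStarAlgebra.nonneg_iff_eq_star_mul_self.mp hP.posSemidef.nonneg
  rw [star_eq_conjTranspose, conjTranspose_eq_transpose_of_trivial] at hB
  refine ⟨B, fun h => hP.det_pos.ne' ?_, hB⟩
  rw [hB, det_mul, h, mul_zero]

lemma integral_exp_neg_dotProduct_self (k : ℕ) :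
    ∫ w : Fin k → ℝ, Real.exp (-(w ⬝ᵥ w) / 2) = (2 * π) ^ ((k : ℝ) / 2) := by
  have h1 : ∀ w : Fin k → ℝ,
      Real.exp (-(w ⬝ᵥ w) / 2) = ∏ i, Real.exp (-(1 / 2 : ℝ) * w i ^ 2) := fun w => by
    rw [← Real.exp_sum, ← Finset.mul_sum]
    congr 1
    simp only [dotProduct, ← pow_two]
    ring
  simp_rw [h1]
  rw [integral_fintype_prod_volume_eq_pow (fun t : ℝ => Real.exp (-(1 / 2 : ℝ) * t ^ 2)),
    integral_gaussian, Fintype.card_fin, Real.sqrt_eq_rpow, ← Real.rpow_mul_natCast (by positivity)]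
  congr 1 <;> ring

lemma integral_comp_mulVec {k : ℕ} {B : Matrix (Fin k) (Fin k) ℝ} (hB : B.det ≠ 0)
    (f : (Fin k → ℝ) → ℝ) (hf : Continuous f) :
    ∫ z, f (B *ᵥ z) = |B.det|⁻¹ * ∫ w, f w := by
  have h := integral_map (μ := volume) (φ := toLin' B) (f := f)
    (LinearMap.continuous_on_pi _).measurable.aemeasurable hf.aestronglyMeasurable
  rw [Real.map_matrix_volume_pi_eq_smul_volume_pi hB, integral_smul_measure,
    ENNReal.toReal_ofReal (abs_nonneg _), abs_inv, smul_eq_mul] at h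
  simpa only [toLin'_apply] using h.symm

/-- The Gaussian density has total mass one. -/
lemma integral_gaussD {k : ℕ} (m : Fin k → ℝ) {S : Matrix (Fin k) (Fin k) ℝ} (hS : S.PosDef) :
    ∫ x, gaussD m S x = 1 := by
  obtain ⟨B, hB, hSB⟩ := hS.inv.exists_transpose_mul_self
  have hdet : S.det = |B.det| ^ (-2 : ℝ) := by
    have h : S.det⁻¹ = |B.det| ^ 2 := by
      rw [← Ring.inverse_eq_inv', ← det_nonsing_inv, hSB, det_mul, det_transpose, sq_abs, pow_two]
    rw [Real.rpow_neg (abs_nonneg _), Real.rpow_two, ← h, inv_inv]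
  have hquad : ∀ z : Fin k → ℝ, z ⬝ᵥ (S⁻¹ *ᵥ z) = (B *ᵥ z) ⬝ᵥ (B *ᵥ z) := fun z => by
    rw [hSB, ← mulVec_mulVec, dotProduct_mulVec, vecMul_transpose]
  simp only [gaussD]
  rw [integral_const_mul,
    integral_sub_right_eq_self (fun z : Fin k → ℝ => Real.exp (-(z ⬝ᵥ (S⁻¹ *ᵥ z)) / 2)) m]
  simp_rw [hquad]
  rw [integral_comp_mulVec hB (fun w => Real.exp (-(w ⬝ᵥ w) / 2)) (by fun_prop),
    integral_exp_neg_dotProduct_self, hdet, ← Real.rpow_mul (abs_nonneg _), neg_div,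
    Real.rpow_neg (by positivity)]
  have h2 : (0 : ℝ) < (2 * π) ^ ((k : ℝ) / 2) := by positivity
  have h3 : |B.det| ≠ 0 := abs_ne_zero.mpr hB
  norm_num
  field_simp

/-- Completing the square in a quadratic form with symmetric invertible matrix. -/
lemma dotProduct_mulVec_sub_inv_mulVec {k : ℕ} {A : Matrix (Fin k) (Fin k) ℝ} (hA : A.PosDef)
    (u w : Fin k → ℝ) :
    (u - A⁻¹ *ᵥ w) ⬝ᵥ (A *ᵥ (u - A⁻¹ *ᵥ w))
      = u ⬝ᵥ (A *ᵥ u) - 2 * (u ⬝ᵥ w) + w ⬝ᵥ (A⁻¹ *ᵥ w) := by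
  have hT : Aᵀ = A := by simpa using hA.isHermitian.eq
  have h1 : A *ᵥ (A⁻¹ *ᵥ w) = w := by
    rw [mulVec_mulVec, mul_nonsing_inv _ (isUnit_iff_ne_zero.mpr hA.det_pos.ne'), one_mulVec]
  have h2 : (A⁻¹ *ᵥ w) ⬝ᵥ (A *ᵥ u) = u ⬝ᵥ w := by
    rw [dotProduct_mulVec, ← mulVec_transpose, hT, h1, dotProduct_comm]
  rw [mulVec_sub, h1, sub_dotProduct, dotProduct_sub, dotProduct_sub, h2,
    dotProduct_comm (A⁻¹ *ᵥ w) w]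
  ring

/-- Expansion of the sum of the observation and background misfits around the background mean. -/
lemma misfit_add_background {n d : ℕ} (H : Matrix (Fin d) (Fin n) ℝ)
    {Q : Matrix (Fin d) (Fin d) ℝ} (hQ : Qᵀ = Q) (P : Matrix (Fin n) (Fin n) ℝ)
    (u : Fin n → ℝ) (v : Fin d → ℝ) :
    (v - H *ᵥ u) ⬝ᵥ (Q *ᵥ (v - H *ᵥ u)) + u ⬝ᵥ (P *ᵥ u)
      = u ⬝ᵥ ((Hᵀ * Q * H + P) *ᵥ u) - 2 * (u ⬝ᵥ (Hᵀ *ᵥ (Q *ᵥ v))) + v ⬝ᵥ (Q *ᵥ v) := by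
  have h1 : ∀ w, u ⬝ᵥ (Hᵀ *ᵥ w) = (H *ᵥ u) ⬝ᵥ w := fun w => by
    rw [dotProduct_mulVec, vecMul_transpose]
  have h2 : v ⬝ᵥ (Q *ᵥ (H *ᵥ u)) = (H *ᵥ u) ⬝ᵥ (Q *ᵥ v) := by
    rw [dotProduct_mulVec, ← mulVec_transpose, hQ, dotProduct_comm]
  rw [add_mulVec, dotProduct_add, ← mulVec_mulVec, ← mulVec_mulVec, h1, h1, mulVec_sub,
    sub_dotProduct, dotProduct_sub, dotProduct_sub, h2]
  ring

/-- **Kalman analysis step.** With affine observation operator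
`𝓗(x) = Hx + c`, Gaussian observation error covariance `R`, Gaussian prior
`N(μb, Sb)` and observation `y`, the normalized Bayesian posterior density
`x ↦ ℓ(x) q_b(x) / ∫ ℓ q_b` (where `ℓ(x) = N(Hx+c, R)(y)`) is the Gaussian density
`N(μa, Sa)` with `Sa = (Hᵀ R⁻¹ H + Sb⁻¹)⁻¹` and
`μa = μb + Sa Hᵀ R⁻¹ (y − (Hμb + c))`. -/
theorem statement_10 {n d : ℕ}
    (H : Matrix (Fin d) (Fin n) ℝ) (c : Fin d → ℝ)
    (R : Matrix (Fin d) (Fin d) ℝ) (hR : R.PosDef)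
    (Sb : Matrix (Fin n) (Fin n) ℝ) (hSb : Sb.PosDef)
    (μb : Fin n → ℝ) (y : Fin d → ℝ) :
    ∀ x : Fin n → ℝ,
      gaussD (H *ᵥ x + c) R y * gaussD μb Sb x
          / (∫ z, gaussD (H *ᵥ z + c) R y * gaussD μb Sb z)
        = gaussD
            (μb + (Hᵀ * R⁻¹ * H + Sb⁻¹)⁻¹ *ᵥ (Hᵀ *ᵥ (R⁻¹ *ᵥ (y - (H *ᵥ μb + c)))))
            ((Hᵀ * R⁻¹ * H + Sb⁻¹)⁻¹) x := by
  have hA : (Hᵀ * R⁻¹ * H + Sb⁻¹).PosDef := by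
    have h := hR.inv.posSemidef.conjTranspose_mul_mul_same H
    rw [conjTranspose_eq_transpose_of_trivial] at h
    exact PosDef.posSemidef_add h hSb.inv
  have hQ : (R⁻¹)ᵀ = R⁻¹ := by simpa using hR.inv.isHermitian.eq
  have hAdet := isUnit_iff_ne_zero.mpr hA.det_pos.ne'
  have hSdet := hA.inv.det_pos
  have hRdet := hR.det_pos
  have hSbdet := hSb.det_pos
  set A := Hᵀ * R⁻¹ * H + Sb⁻¹
  set v := y - (H *ᵥ μb + c) with hv
  set w := Hᵀ *ᵥ (R⁻¹ *ᵥ v)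
  obtain ⟨K, hK, hprod⟩ : ∃ K : ℝ, K ≠ 0 ∧ ∀ z,
      gaussD (H *ᵥ z + c) R y * gaussD μb Sb z = K * gaussD (μb + A⁻¹ *ᵥ w) A⁻¹ z := by
    refine ⟨(2 * π) ^ (-(d : ℝ) / 2) * R.det ^ (-(1 : ℝ) / 2) * Sb.det ^ (-(1 : ℝ) / 2)
      * (A⁻¹.det ^ (-(1 : ℝ) / 2))⁻¹
      * Real.exp (-(v ⬝ᵥ (R⁻¹ *ᵥ v) - w ⬝ᵥ (A⁻¹ *ᵥ w)) / 2), by positivity, fun z => ?_⟩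
    have hres : y - (H *ᵥ z + c) = v - H *ᵥ (z - μb) := by
      rw [hv, mulVec_sub]; abel
    have hmean : z - (μb + A⁻¹ *ᵥ w) = (z - μb) - A⁻¹ *ᵥ w := by abel
    have hexp : Real.exp (-((v - H *ᵥ (z - μb)) ⬝ᵥ (R⁻¹ *ᵥ (v - H *ᵥ (z - μb)))) / 2)
          * Real.exp (-((z - μb) ⬝ᵥ (Sb⁻¹ *ᵥ (z - μb))) / 2)
        = Real.exp (-(v ⬝ᵥ (R⁻¹ *ᵥ v) - w ⬝ᵥ (A⁻¹ *ᵥ w)) / 2)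
          * Real.exp (-((z - μb - A⁻¹ *ᵥ w) ⬝ᵥ (A *ᵥ (z - μb - A⁻¹ *ᵥ w))) / 2) := by
      rw [← Real.exp_add, ← Real.exp_add, dotProduct_mulVec_sub_inv_mulVec hA]
      congr 1
      linarith [misfit_add_background H hQ Sb⁻¹ (z - μb) v]
    simp only [gaussD]
    rw [nonsing_inv_nonsing_inv _ hAdet, hres, hmean, mul_mul_mul_comm, hexp]
    have : A⁻¹.det ^ (-(1 : ℝ) / 2) ≠ 0 := by positivity
    field_simp
  intro x
  simp_rw [hprod]
  rw [integral_const_mul, integral_gaussD _ hA.inv, mul_one, mul_div_cancel_left₀ _ hK]
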